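/- arXiv:math/0510387 — 3 statements merged into one kernel-verified Lean document; each statement's English description precedes it below -/
import Mathlib

section
/- Let G be a finite simple graph without isolated vertices. If σ_v(G) = α(G) and α(G) = τ(G), then G has a perfect matching. -/
/-- A set of vertices is stable (independent) if no two of its vertices are adjacent. -/
def IsStable {V : Type*} (G : SimpleGraph V) (S : Set V) : Prop :=
  ∀ ⦃u⦄, u ∈ S → ∀ ⦃v⦄, v ∈ S → ¬ G.Adj u v

/-- A set of vertices is a vertex cover if it meets every edge. -/
def IsCover {V : Type*} (G : SimpleGraph V) (C : Set V) : Prop :=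
  ∀ ⦃u v⦄, G.Adj u v → u ∈ C ∨ v ∈ C

/-- The stability number α(G): the maximum size of a stable set. -/
noncomputable def alphaNum {V : Type*} (G : SimpleGraph V) : ℕ :=
  sSup {n | ∃ S : Set V, IsStable G S ∧ S.ncard = n}

/-- The vertex covering number τ(G): the minimum size of a vertex cover. -/
noncomputable def tauNum {V : Type*} (G : SimpleGraph V) : ℕ :=
  sInf {n | ∃ C : Set V, IsCover G C ∧ C.ncard = n}

/-- An inclusionwise maximal stable set. -/
def IsMaximalStable {V : Type*} (G : SimpleGraph V) (S : Set V) : Prop :=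
  IsStable G S ∧ ∀ T : Set V, IsStable G T → S ⊆ T → S = T

/-- The σ_v-cover number: the maximum m such that every vertex belongs to a
maximal stable set with at least m vertices. -/
noncomputable def sigmaV {V : Type*} (G : SimpleGraph V) : ℕ :=
  sSup {m | ∀ v : V, ∃ S : Set V, v ∈ S ∧ IsMaximalStable G S ∧ m ≤ S.ncard}

/-- α_core(G): the intersection of all maximum stable sets of G. -/
def alphaCore {V : Type*} (G : SimpleGraph V) : Set V :=
  {v | ∀ S : Set V, IsStable G S → S.ncard = alphaNum G → v ∈ S}

/-- τ_core(G): the intersection of all minimum vertex covers of G. -/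
def tauCore {V : Type*} (G : SimpleGraph V) : Set V :=
  {v | ∀ C : Set V, IsCover G C → C.ncard = tauNum G → v ∈ C}

open Finset in
/-- If every vertex lies in a maximum stable set, then a stable set has at least as many neighbours
as elements. -/
theorem IsStable.card_le_card_neighbors {V : Type*} [Fintype V] {G : SimpleGraph V} {n : ℕ}
    [DecidableRel G.Adj]
    (hiso : ∀ v, ∃ w, G.Adj v w)
    (hmax : ∀ T : Finset V, IsStable G T → #T ≤ n)
    (hcov : ∀ v, ∃ T : Finset V, v ∈ T ∧ IsStable G T ∧ n ≤ #T)
    (A : Finset V) (hA : IsStable G A) : #A ≤ #{w | ∃ a ∈ A, G.Adj a w} := by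
  classical
  induction A using Finset.strongInduction with
  | H A ih =>
  rcases A.eq_empty_or_nonempty with rfl | ⟨a, ha⟩
  · simp
  obtain ⟨v, hav⟩ := hiso a
  obtain ⟨T, hvT, hT, hnT⟩ := hcov v
  have haT : a ∉ T := fun h => hT h hvT hav
  have hsub : A ∩ T ⊂ A :=
    Finset.ssubset_iff_subset_ne.2 ⟨inter_subset_left, fun h => haT (by grind)⟩
  let P : Finset V := {w | ∃ a ∈ A ∩ T, G.Adj a w}
  have hinter : #(A ∩ T) ≤ #P :=
    ih (A ∩ T) hsub fun u hu w hw => hA (by simp_all) (by simp_all)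
  let Q : Finset V := {w ∈ T | ∃ a ∈ A \ T, G.Adj a w}
  have hPQ : Disjoint P Q := by
    rw [Finset.disjoint_left]
    intro w hP hQ
    obtain ⟨b, hb, hbw⟩ := (mem_filter.1 hP).2
    exact hT (mem_inter.1 hb).2 (mem_filter.1 hQ).1 hbw
  have hexch : IsStable G (↑((T \ Q) ∪ (A \ T)) : Set V) := by
    have key : ∀ u ∈ T \ Q, ∀ w ∈ A \ T, ¬ G.Adj w u := fun u hu w hw h =>
      (mem_sdiff.1 hu).2 (mem_filter.2 ⟨(mem_sdiff.1 hu).1, w, hw, h⟩)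
    intro u hu w hw
    rcases mem_union.1 (mem_coe.1 hu) with hu | hu <;>
      rcases mem_union.1 (mem_coe.1 hw) with hw | hw
    · exact hT (mem_sdiff.1 hu).1 (mem_sdiff.1 hw).1
    · exact fun h => key u hu w hw h.symm
    · exact key w hw u hu
    · exact hA (mem_sdiff.1 hu).1 (mem_sdiff.1 hw).1
  have hcard := hmax _ hexch
  have hdisj : Disjoint (T \ Q) (A \ T) := by
    rw [Finset.disjoint_left]
    exact fun w hw hw' => (mem_sdiff.1 hw').2 (mem_sdiff.1 hw).1
  have hQT : Q ⊆ T := filter_subset _ _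
  rw [card_union_of_disjoint hdisj, card_sdiff_of_subset hQT] at hcard
  have hQle := card_le_card hQT
  have hAT := card_inter_add_card_sdiff A T
  calc #A ≤ #P + #Q := by omega
    _ = #(P ∪ Q) := (card_union_of_disjoint hPQ).symm
    _ ≤ _ := card_le_card fun w hw => by
      rcases mem_union.1 hw with hw | hw
      · obtain ⟨b, hb, hbw⟩ := (mem_filter.1 hw).2
        exact mem_filter.2 ⟨mem_univ _, b, (mem_inter.1 hb).1, hbw⟩
      · obtain ⟨-, b, hb, hbw⟩ := mem_filter.1 hw
        exact mem_filter.2 ⟨mem_univ _, b, (mem_sdiff.1 hb).1, hbw⟩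

/-- An injection along edges from a vertex set onto its complement is a perfect matching. -/
theorem SimpleGraph.exists_isPerfectMatching_of_injective {V : Type*} {G : SimpleGraph V}
    {S : Set V} {f : S → V} (hf : Function.Injective f) (hadj : ∀ s : S, G.Adj s (f s))
    (hrange : Set.range f = Sᶜ) : ∃ M : G.Subgraph, M.IsPerfectMatching := by
  have hfS (s : S) : f s ∉ S := by
    have : f s ∈ Sᶜ := hrange ▸ Set.mem_range_self s
    exact this
  let M : G.Subgraph :=
    { verts := Set.univ
      Adj := fun v w => ∃ s : S, (v = s ∧ w = f s) ∨ (w = s ∧ v = f s)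
      adj_sub := by
        rintro v w ⟨s, ⟨rfl, rfl⟩ | ⟨rfl, rfl⟩⟩
        · exact hadj s
        · exact (hadj s).symm
      edge_vert := fun _ => Set.mem_univ _
      symm := ⟨fun _ _ ⟨s, h⟩ => ⟨s, h.symm⟩⟩ }
  refine ⟨M, Subgraph.isPerfectMatching_iff.2 fun v => ?_⟩
  by_cases hv : v ∈ S
  · refine ⟨f ⟨v, hv⟩, ⟨⟨v, hv⟩, Or.inl ⟨rfl, rfl⟩⟩, ?_⟩
    rintro w ⟨s, ⟨rfl, rfl⟩ | ⟨rfl, rfl⟩⟩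
    · rfl
    · exact absurd hv (hfS s)
  · obtain ⟨s, rfl⟩ : v ∈ Set.range f := hrange ▸ hv
    refine ⟨s, ⟨s, Or.inr ⟨rfl, rfl⟩⟩, ?_⟩
    rintro w ⟨t, ⟨h, rfl⟩ | ⟨rfl, h⟩⟩
    · exact absurd (h ▸ t.2) hv
    · rw [hf h]

/-- The complement of a stable set is a vertex cover. -/
theorem IsStable.isCover_compl {V : Type*} {G : SimpleGraph V} {S : Set V} (hS : IsStable G S) :
    IsCover G Sᶜ := by
  intro u v h
  by_contra! hc
  exact hS (not_not.1 hc.1) (not_not.1 hc.2) h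

/-- The complement of a vertex cover is stable. -/
theorem IsCover.isStable_compl {V : Type*} {G : SimpleGraph V} {C : Set V} (hC : IsCover G C) :
    IsStable G Cᶜ :=
  fun _ hu _ hv h => (hC h).elim hu hv

theorem exists_isCover_ncard_eq_tauNum {V : Type*} (G : SimpleGraph V) :
    ∃ C : Set V, IsCover G C ∧ C.ncard = tauNum G :=
  Nat.sInf_mem (s := {n | ∃ C : Set V, IsCover G C ∧ C.ncard = n})
    ⟨_, Set.univ, fun _ _ _ => Or.inl trivial, rfl⟩

section Finite

variable {V : Type*} [Finite V]

theorem bddAbove_ncard_isStable (G : SimpleGraph V) :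
    BddAbove {n | ∃ S : Set V, IsStable G S ∧ S.ncard = n} :=
  ⟨Nat.card V, by rintro _ ⟨S, -, rfl⟩; exact Set.ncard_le_card S⟩

theorem IsStable.ncard_le_alphaNum {G : SimpleGraph V} {S : Set V} (hS : IsStable G S) :
    S.ncard ≤ alphaNum G :=
  le_csSup (bddAbove_ncard_isStable G) ⟨S, hS, rfl⟩

theorem exists_isStable_ncard_eq_alphaNum (G : SimpleGraph V) :
    ∃ S : Set V, IsStable G S ∧ S.ncard = alphaNum G :=
  Nat.sSup_mem (s := {n | ∃ S : Set V, IsStable G S ∧ S.ncard = n})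
    ⟨_, ∅, fun _ h => h.elim, rfl⟩ (bddAbove_ncard_isStable G)

/-- Gallai's identity. -/
theorem alphaNum_add_tauNum (G : SimpleGraph V) : alphaNum G + tauNum G = Nat.card V := by
  obtain ⟨S, hS, hSc⟩ := exists_isStable_ncard_eq_alphaNum G
  obtain ⟨C, hC, hCc⟩ := exists_isCover_ncard_eq_tauNum G
  have h1 : tauNum G ≤ Sᶜ.ncard := Nat.sInf_le ⟨_, hS.isCover_compl, rfl⟩
  have h2 := hC.isStable_compl.ncard_le_alphaNum
  have h3 := Set.ncard_add_ncard_compl S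
  have h4 := Set.ncard_add_ncard_compl C
  omega

/-- If `σ_v(G) = α(G)`, every vertex lies in a maximum stable set. -/
theorem exists_isStable_mem_of_sigmaV_eq {G : SimpleGraph V} (h : sigmaV G = alphaNum G) (v : V) :
    ∃ S : Set V, v ∈ S ∧ IsStable G S ∧ alphaNum G ≤ S.ncard := by
  let s := {m | ∀ v : V, ∃ S : Set V, v ∈ S ∧ IsMaximalStable G S ∧ m ≤ S.ncard}
  have hpos : 0 < alphaNum G := by
    have hv : IsStable G {v} := by rintro _ rfl _ rfl; exact G.irrefl
    exact (Set.ncard_singleton v).symm.trans_le hv.ncard_le_alphaNum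
  have hne : s.Nonempty := Set.nonempty_iff_ne_empty.2 fun he => by
    have h0 : sSup s = 0 := he ▸ csSup_empty
    exact hpos.ne' (h.symm.trans h0)
  have hbdd : BddAbove s := ⟨Nat.card V, fun m hm => by
    obtain ⟨S, -, -, hS⟩ := hm v
    exact hS.trans (Set.ncard_le_card S)⟩
  have hmem : sSup s ∈ s := Nat.sSup_mem hne hbdd
  obtain ⟨S, hvS, hS, hcard⟩ := hmem v
  exact ⟨S, hvS, hS.1, h ▸ hcard⟩

end Finite

/-- If G has no isolated vertices, σ_v(G) = α(G) and α(G) = τ(G),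
then G has a perfect matching. -/
theorem stmt_1 {V : Type*} [Fintype V] (G : SimpleGraph V)
    (hiso : ∀ v : V, ∃ w, G.Adj v w)
    (h1 : sigmaV G = alphaNum G) (h2 : alphaNum G = tauNum G) :
    ∃ M : G.Subgraph, M.IsPerfectMatching := by
  classical
  obtain ⟨S, hS, hSc⟩ := exists_isStable_ncard_eq_alphaNum G
  have hall (A : Finset V) (hA : IsStable G A) :=
    hA.card_le_card_neighbors (n := alphaNum G) hiso
      (fun T hT => by simpa using hT.ncard_le_alphaNum)
      (fun v => by
        obtain ⟨T, hvT, hT, hn⟩ := exists_isStable_mem_of_sigmaV_eq h1 v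
        exact ⟨T.toFinset, by simpa, by simpa, by rwa [← Set.ncard_eq_toFinset_card']⟩)
  obtain ⟨f, hf, hadj⟩ := (Fintype.all_card_le_filter_rel_iff_exists_injective
    fun (s : S) w => G.Adj s w).1 fun A => by
      have hA : IsStable G (A.map (.subtype _) : Finset V) := by
        intro u hu w hw
        exact hS (by simp at hu; exact hu.1) (by simp at hw; exact hw.1)
      simpa using hall _ hA
  refine SimpleGraph.exists_isPerfectMatching_of_injective hf hadj
    (Set.eq_of_subset_of_ncard_le ?_ ?_)
  · rintro _ ⟨s, rfl⟩ hs
    exact hS s.2 hs (hadj s)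
  · have hgallai := alphaNum_add_tauNum G
    have hcompl := Set.ncard_add_ncard_compl S
    have hrange : (Set.range f).ncard = S.ncard := by
      rw [← Set.image_univ, Set.ncard_image_of_injective _ hf, Set.ncard_univ,
        Nat.card_coe_set_eq]
    omega
end

section
/- Let a ≥ 1 and t ≥ 2 be natural numbers. Then Γ(a,t) − Γ(a,t−1) = 1 + ⌊(t−1)/a⌋. -/
/-- Γ(a,t): the minimum of Σ C(z_i,2) over nonnegative z_1,…,z_a summing to a + t. -/
noncomputable def Gamma (a t : ℕ) : ℕ :=
  sInf {m | ∃ z : Fin a → ℕ, (∑ i, z i) = a + t ∧ (∑ i, Nat.choose (z i) 2) = m}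

theorem two_mul_choose_two_add_self (n : ℕ) : 2 * n.choose 2 + n = n * n := by
  induction n with
  | zero => rfl
  | succ k ih =>
    rw [Nat.choose_succ_succ' k 1, Nat.choose_one_right]
    linarith

/-- The convex function `n ↦ C(n,2)` lies above its line of slope `q` through `q` and `q + 1`. -/
theorem choose_two_add_mul_le (q z : ℕ) : q.choose 2 + q * z ≤ z.choose 2 + q * q := by
  have hq := two_mul_choose_two_add_self q
  have hz := two_mul_choose_two_add_self z
  rcases le_or_gt z q with h | h
  · obtain ⟨d, rfl⟩ := Nat.exists_eq_add_of_le h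
    nlinarith [Nat.zero_le (d * d)]
  · obtain ⟨d, rfl⟩ := Nat.exists_eq_add_of_lt h
    nlinarith [Nat.zero_le (d * d)]

theorem Gamma_eq {a t q r : ℕ} (hr : r ≤ a) (h : a + t = a * q + r) :
    Gamma a t = a * q.choose 2 + r * q := by
  refine IsLeast.csInf_eq ⟨⟨fun i => q + if (i : ℕ) < r then 1 else 0, ?_, ?_⟩, ?_⟩
  · simp [Finset.sum_add_distrib, Fin.card_filter_val_lt, hr, h]
  · have hz (i : Fin a) : (q + if (i : ℕ) < r then 1 else 0).choose 2 =
        q.choose 2 + if (i : ℕ) < r then q else 0 := by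
      split_ifs
      · rw [Nat.choose_succ_succ' q 1, Nat.choose_one_right, add_comm]
      · rfl
    simp only [hz]
    simp [Finset.sum_add_distrib, ← Finset.sum_filter, Fin.card_filter_val_lt, hr]
  · rintro _ ⟨z, hz, rfl⟩
    have hsum := Finset.sum_le_sum fun i (_ : i ∈ Finset.univ) => choose_two_add_mul_le q (z i)
    simp only [Finset.sum_add_distrib, ← Finset.mul_sum, hz, h, Finset.sum_const,
      Finset.card_univ, Fintype.card_fin, smul_eq_mul] at hsum
    linarith

/-- For a ≥ 1 and t ≥ 2, Γ(a,t) − Γ(a,t−1) = 1 + ⌊(t−1)/a⌋. -/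
theorem stmt_13 (a t : ℕ) (ha : 1 ≤ a) (ht : 2 ≤ t) :
    Gamma a t - Gamma a (t - 1) = 1 + (t - 1) / a := by
  have hlt : (t - 1) % a < a := Nat.mod_lt _ ha
  have hdiv := Nat.div_add_mod (t - 1) a
  have hmul := mul_add a 1 ((t - 1) / a)
  rw [Gamma_eq (t := t) (q := 1 + (t - 1) / a) (r := (t - 1) % a + 1) hlt (by omega),
    Gamma_eq (t := t - 1) (q := 1 + (t - 1) / a) (r := (t - 1) % a) hlt.le (by omega),
    add_one_mul, ← add_assoc, Nat.add_sub_cancel_left]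
end

section
/- Let k ≥ 1 and let a_1, …, a_k ≥ 1 and t_1, …, t_k ≥ 1 be natural numbers. Then Σ_{i=1}^{k} Γ(a_i, t_i) ≥ Γ(Σ_{i=1}^{k} a_i, Σ_{i=1}^{k} t_i). Moreover, for k = 2, if ⌊t_1/a_1⌋ = ⌊t_2/a_2⌋ then Γ(a_1,t_1) + Γ(a_2,t_2) = Γ(a_1 + a_2, t_1 + t_2). -/
theorem Gamma_le {ι : Type*} [Fintype ι] {a t : ℕ} (e : ι ≃ Fin a) (z : ι → ℕ)
    (hz : ∑ i, z i = a + t) : Gamma a t ≤ ∑ i, (z i).choose 2 := by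
  refine Nat.sInf_le ⟨z ∘ e.symm, ?_, ?_⟩
  · rw [← hz]
    exact e.symm.sum_comp z
  · exact e.symm.sum_comp fun i => (z i).choose 2

theorem exists_sum_choose_eq_Gamma {a : ℕ} (ha : 1 ≤ a) (t : ℕ) :
    ∃ z : Fin a → ℕ, ∑ i, z i = a + t ∧ ∑ i, (z i).choose 2 = Gamma a t := by
  refine Nat.sInf_mem (s := {m | ∃ z : Fin a → ℕ, (∑ i, z i) = a + t ∧
    (∑ i, Nat.choose (z i) 2) = m}) ⟨_, Pi.single ⟨0, ha⟩ (a + t), ?_, rfl⟩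
  simp

theorem Gamma_sum_le_sum_Gamma {k : ℕ} (a t : Fin k → ℕ) (ha : ∀ i, 1 ≤ a i) :
    Gamma (∑ i, a i) (∑ i, t i) ≤ ∑ i, Gamma (a i) (t i) := by
  choose z hz hzΓ using fun i => exists_sum_choose_eq_Gamma (ha i) (t i)
  refine (Gamma_le finSigmaFinEquiv (fun p : (i : Fin k) × Fin (a i) => z p.1 p.2) ?_).trans_eq ?_
  · simp [Fintype.sum_sigma, hz, Finset.sum_add_distrib]
  · simp [Fintype.sum_sigma, hzΓ]

theorem mul_succ_le_choose_two_add_choose_two (z q : ℕ) :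
    z * (q + 1) ≤ z.choose 2 + (q + 2).choose 2 := by
  suffices h : (z * (q + 1) : ℚ) ≤ z.choose 2 + (q + 2).choose 2 by exact_mod_cast h
  rw [Nat.cast_choose_two, Nat.cast_choose_two]
  push_cast
  rcases le_or_gt z (q + 1) with h | h
  · have h' : (z : ℚ) ≤ q + 1 := by exact_mod_cast h
    nlinarith
  · have h' : (q : ℚ) + 1 + 1 ≤ z := by exact_mod_cast h
    nlinarith

theorem choose_two_add_choose_two_eq_mul_succ {z q : ℕ} (h : z = q + 1 ∨ z = q + 2) :
    z.choose 2 + (q + 2).choose 2 = z * (q + 1) := by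
  suffices h : (z.choose 2 + (q + 2).choose 2 : ℚ) = z * (q + 1) by exact_mod_cast h
  rw [Nat.cast_choose_two, Nat.cast_choose_two]
  rcases h with rfl | rfl <;> push_cast <;> ring

theorem Gamma_add_mul_choose_two {a : ℕ} (ha : 1 ≤ a) (t : ℕ) :
    Gamma a t + a * (t / a + 2).choose 2 = (a + t) * (t / a + 1) := by
  set q := t / a with hq
  have sum_add (z : Fin a → ℕ) : ∑ i, (z i).choose 2 + a * (q + 2).choose 2 =
      ∑ i, ((z i).choose 2 + (q + 2).choose 2) := by
    simp [Finset.sum_add_distrib]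
  apply le_antisymm
  · let z : Fin a → ℕ := fun i => q + 1 + if i.val < t % a then 1 else 0
    have hz : ∑ i, z i = a + t := by
      have hr := Nat.mod_lt t ha
      have hdiv := Nat.div_add_mod t a
      simp only [z, Finset.sum_add_distrib, Finset.sum_boole, Fin.card_filter_val_lt]
      simp only [Finset.sum_const, Finset.card_univ, Fintype.card_fin, smul_eq_mul, Nat.cast_id,
        min_eq_right hr.le]
      rw [← hq] at hdiv
      linarith
    calc Gamma a t + a * (q + 2).choose 2
        ≤ ∑ i, (z i).choose 2 + a * (q + 2).choose 2 := by
          gcongr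
          exact Gamma_le (Equiv.refl _) z hz
      _ = ∑ i, z i * (q + 1) := by
          rw [sum_add]
          refine Finset.sum_congr rfl fun i _ => choose_two_add_choose_two_eq_mul_succ ?_
          by_cases hi : i.val < t % a <;> simp [z, hi]
      _ = (a + t) * (q + 1) := by rw [← Finset.sum_mul, hz]
  · obtain ⟨z, hz, hzΓ⟩ := exists_sum_choose_eq_Gamma ha t
    rw [← hz, ← hzΓ, sum_add, Finset.sum_mul]
    exact Finset.sum_le_sum fun i _ => mul_succ_le_choose_two_add_choose_two (z i) q

theorem Nat.add_div_add_of_div_eq {a₁ t₁ a₂ t₂ : ℕ} (h₁ : 0 < a₁) (h₂ : 0 < a₂)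
    (h : t₁ / a₁ = t₂ / a₂) : (t₁ + t₂) / (a₁ + a₂) = t₁ / a₁ := by
  have hl₁ := Nat.div_mul_le_self t₁ a₁
  have hl₂ := Nat.div_mul_le_self t₂ a₂
  have hu₁ := Nat.lt_mul_div_succ t₁ h₁
  have hu₂ := Nat.lt_mul_div_succ t₂ h₂
  rw [← h] at hl₂ hu₂
  apply Nat.div_eq_of_lt_le <;> linarith

/-- Superadditivity of Γ: Σ Γ(a_i,t_i) ≥ Γ(Σ a_i, Σ t_i); moreover for two
pairs with ⌊t₁/a₁⌋ = ⌊t₂/a₂⌋ we have equality. -/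
theorem stmt_14 :
    (∀ (k : ℕ), 1 ≤ k → ∀ (a t : Fin k → ℕ),
      (∀ i, 1 ≤ a i) → (∀ i, 1 ≤ t i) →
      Gamma (∑ i, a i) (∑ i, t i) ≤ ∑ i, Gamma (a i) (t i)) ∧
    (∀ a₁ t₁ a₂ t₂ : ℕ, 1 ≤ a₁ → 1 ≤ t₁ → 1 ≤ a₂ → 1 ≤ t₂ →
      t₁ / a₁ = t₂ / a₂ →
      Gamma a₁ t₁ + Gamma a₂ t₂ = Gamma (a₁ + a₂) (t₁ + t₂)) := by
  refine ⟨fun k _ a t ha _ => Gamma_sum_le_sum_Gamma a t ha, ?_⟩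
  intro a₁ t₁ a₂ t₂ ha₁ _ ha₂ _ h
  have h₁ := Gamma_add_mul_choose_two ha₁ t₁
  have h₂ := Gamma_add_mul_choose_two ha₂ t₂
  have h₁₂ := Gamma_add_mul_choose_two (a := a₁ + a₂) (by lia) (t₁ + t₂)
  rw [← h] at h₂
  rw [Nat.add_div_add_of_div_eq ha₁ ha₂ h] at h₁₂
  linarith
end
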